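/- arXiv:math/0510231 — 4 statements merged into one kernel-verified Lean document; each statement's English description precedes it below -/
import Mathlib

section
/- For every dimension n ≥ 1 and every integer k ≥ 1 there exists a function C_k : [0,∞)⁴ → [0,∞) with the following property: whenever U and V are open subsets of ℝⁿ, φ : U → V is a C^k diffeomorphism, M : U → Matₙ(ℝ) and N : V → Matₙ(ℝ) are C^k maps taking values in symmetric positive definite matrices such that Dφ(x)ᵀ · N(φ(x)) · Dφ(x) = M(x) for all x ∈ U, and the norms ‖M‖_{C^k(U)}, ‖M⁻¹‖_{C^k(U)}, ‖N‖_{C^k(V)}, ‖N⁻¹‖_{C^k(V)} are all finite, then sup_{x∈U} ‖D^kφ(x)‖ ≤ C_k(‖M‖_{C^k(U)}, ‖M⁻¹‖_{C^k(U)}, ‖N‖_{C^k(V)}, ‖N⁻¹‖_{C^k(V)}). -/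
open Set
open scoped RealInnerProductSpace

/-- The `C^k` norm of a map on a set: the sum over `0 ≤ i ≤ k` of the suprema of the
norms of the `i`-th iterated (Fréchet) derivatives on the set. -/
noncomputable def CkSupNorm {E F : Type*} [NormedAddCommGroup E] [NormedSpace ℝ E]
    [NormedAddCommGroup F] [NormedSpace ℝ F] (k : ℕ) (f : E → F) (s : Set E) : ℝ :=
  ∑ i ∈ Finset.range (k + 1), ⨆ x ∈ s, ‖iteratedFDerivWithin ℝ i f s x‖

/-- Finiteness of the `C^k` norm of a map on a set. -/
def CkBdd {E F : Type*} [NormedAddCommGroup E] [NormedSpace ℝ E]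
    [NormedAddCommGroup F] [NormedSpace ℝ F] (k : ℕ) (f : E → F) (s : Set E) : Prop :=
  ∀ i ≤ k, BddAbove ((fun x => ‖iteratedFDerivWithin ℝ i f s x‖) '' s)

structure Bd {E F : Type*} [NormedAddCommGroup E] [NormedSpace ℝ E]
    [NormedAddCommGroup F] [NormedSpace ℝ F] (m : ℕ) (f : E → F) (s : Set E) (C : ℝ) : Prop where
  cd : ContDiffOn ℝ m f s
  le : ∀ i ≤ m, ∀ x ∈ s, ‖iteratedFDerivWithin ℝ i f s x‖ ≤ C

section BdLemmas
variable {E F G H : Type} [NormedAddCommGroup E] [NormedSpace ℝ E]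
    [NormedAddCommGroup F] [NormedSpace ℝ F] [NormedAddCommGroup G] [NormedSpace ℝ G]
    [NormedAddCommGroup H] [NormedSpace ℝ H]

theorem Bd.mono {m m' : ℕ} {f : E → F} {s : Set E} {C : ℝ} (h : Bd m f s C) (hm : m' ≤ m) :
    Bd m' f s C :=
  ⟨h.cd.of_le (by exact_mod_cast hm), fun i hi x hx => h.le i (hi.trans hm) x hx⟩

theorem Bd.congr {m : ℕ} {f g : E → F} {s : Set E} {C : ℝ} (h : Bd m f s C) (hfg : EqOn g f s) :
    Bd m g s C :=
  ⟨h.cd.congr hfg, fun i hi x hx => by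
    rw [iteratedFDerivWithin_congr hfg hx]; exact h.le i hi x hx⟩

theorem Bd.fderivWithin {m : ℕ} {f : E → F} {s : Set E} {C : ℝ} (hs : IsOpen s)
    (h : Bd (m + 1) f s C) : Bd m (fderivWithin ℝ f s) s C :=
  ⟨h.cd.fderivWithin hs.uniqueDiffOn (by norm_cast), fun i hi x hx => by
    rw [norm_iteratedFDerivWithin_fderivWithin hs.uniqueDiffOn hx]
    exact h.le _ (by omega) x hx⟩

theorem Bd.clm {m : ℕ} {f : E → F} {s : Set E} {C : ℝ} (hs : IsOpen s) (L : F →L[ℝ] G)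
    (h : Bd m f s C) : Bd m (fun x => L (f x)) s (‖L‖ * C) :=
  ⟨L.contDiff.comp_contDiffOn h.cd, fun i hi x hx => by
    refine (L.norm_iteratedFDerivWithin_comp_left (h.cd x hx) hs.uniqueDiffOn hx
      (by exact_mod_cast hi)).trans ?_
    gcongr
    exact h.le i hi x hx⟩

theorem Bd.sub {m : ℕ} {f g : E → F} {s : Set E} {C D : ℝ} (hs : IsOpen s)
    (hf : Bd m f s C) (hg : Bd m g s D) : Bd m (fun x => f x - g x) s (C + D) :=
  ⟨hf.cd.sub hg.cd, fun i hi x hx => by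
    have hi' : (i : WithTop ℕ∞) ≤ m := by exact_mod_cast hi
    have := iteratedFDerivWithin_sub_apply ((hf.cd x hx).of_le hi') ((hg.cd x hx).of_le hi')
      hs.uniqueDiffOn hx
    have h2 : (fun x => f x - g x) = f - g := rfl
    rw [h2, this]
    exact (norm_sub_le _ _).trans (add_le_add (hf.le i hi x hx) (hg.le i hi x hx))⟩

theorem Bd.bilin {m : ℕ} {f : E → F} {g : E → G} {s : Set E} {C D : ℝ} (hs : IsOpen s)
    (B : F →L[ℝ] G →L[ℝ] H)
    (hf : Bd m f s C) (hg : Bd m g s D) :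
    Bd m (fun x => B (f x) (g x)) s (‖B‖ * (2 ^ m * (C * D))) := by
  refine ⟨?_, fun i hi x hx => ?_⟩
  · exact B.isBoundedBilinearMap.contDiff.comp_contDiffOn (hf.cd.prodMk hg.cd)
  · have hC : 0 ≤ C := (norm_nonneg _).trans (hf.le 0 (Nat.zero_le _) x hx)
    have hD : 0 ≤ D := (norm_nonneg _).trans (hg.le 0 (Nat.zero_le _) x hx)
    refine (B.norm_iteratedFDerivWithin_le_of_bilinear hf.cd hg.cd
      hs.uniqueDiffOn hx (n := i) (by exact_mod_cast hi)).trans ?_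
    gcongr
    calc _ ≤ ∑ j ∈ Finset.range (i + 1), (i.choose j : ℝ) * (C * D) := by
          apply Finset.sum_le_sum
          intro j hj
          rw [mul_assoc]
          have := Finset.mem_range.1 hj
          gcongr
          · exact hf.le _ (by omega) x hx
          · exact hg.le _ (by omega) x hx
      _ = 2 ^ i * (C * D) := by
          rw [← Finset.sum_mul]
          congr 1
          exact_mod_cast Nat.sum_range_choose i
      _ ≤ _ := by
          gcongr
          norm_num

theorem Bd.comp {m : ℕ} {g : F → G} {f : E → F} {s : Set E} {t : Set F} {C D : ℝ}
    (hs : IsOpen s) (ht : IsOpen t) (hst : MapsTo f s t)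
    (hg : Bd m g t C) (hfc : ContDiffOn ℝ (m + 1 : ℕ) f s)
    (hf : Bd m (_root_.fderivWithin ℝ f s) s D) :
    Bd m (fun x => g (f x)) s (m.factorial * C * (max 1 D) ^ m) := by
  have hfc' : ContDiffOn ℝ m f s := hfc.of_le (by norm_cast; omega)
  refine ⟨hg.cd.comp hfc' hst, fun i hi x hx => ?_⟩
  have hC : 0 ≤ C := (norm_nonneg _).trans (hg.le 0 (Nat.zero_le _) (f x) (hst hx))
  refine (norm_iteratedFDerivWithin_comp_le hg.cd hfc' (n := i) (by exact_mod_cast hi)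
    ht.uniqueDiffOn hs.uniqueDiffOn hst hx (C := C) (D := max 1 D) 
    (fun j hj => hg.le j (hj.trans hi) _ (hst hx)) (fun j hj1 hj => ?_)).trans ?_
  · obtain ⟨j, rfl⟩ : ∃ j', j = j' + 1 := ⟨j - 1, by omega⟩
    rw [← norm_iteratedFDerivWithin_fderivWithin hs.uniqueDiffOn hx]
    refine (hf.le j (by omega) x hx).trans ((le_max_right 1 D).trans ?_)
    exact le_self_pow₀ (le_max_left _ _) (by omega)
  · gcongr
    exact le_max_left _ _

theorem Bd.of_fderivWithin {m : ℕ} {f : E → F} {s : Set E} {C D : ℝ} (hs : IsOpen s)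
    (hc : ContDiffOn ℝ (m + 1 : ℕ) f s)
    (h : Bd m (_root_.fderivWithin ℝ f s) s D) (h0 : ∀ x ∈ s, ‖f x‖ ≤ C) :
    Bd (m + 1) f s (max C D) := by
  refine ⟨hc, fun i hi x hx => ?_⟩
  rcases i with _ | i
  · simpa using Or.inl (h0 x hx)
  · rw [← norm_iteratedFDerivWithin_fderivWithin hs.uniqueDiffOn hx]
    exact (h.le i (by omega) x hx).trans (le_max_right _ _)

theorem Bd.of_CkBdd {k : ℕ} {f : E → F} {s : Set E} {B : ℝ}
    (hc : ContDiffOn ℝ k f s) (h : CkBdd k f s) (hB : CkSupNorm k f s ≤ B) : Bd k f s B := by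
  refine ⟨hc, fun i hi x hx => le_trans ?_ hB⟩
  have hnn : ∀ i, 0 ≤ ⨆ x ∈ s, ‖iteratedFDerivWithin ℝ i f s x‖ := fun i =>
    Real.iSup_nonneg fun x => Real.iSup_nonneg fun _ => norm_nonneg _
  have h1 : (⨆ x ∈ s, ‖iteratedFDerivWithin ℝ i f s x‖) ≤ CkSupNorm k f s := by
    unfold CkSupNorm
    exact Finset.single_le_sum (f := fun i => ⨆ x ∈ s, ‖iteratedFDerivWithin ℝ i f s x‖)
      (fun j _ => hnn j) (Finset.mem_range.2 (by omega))
  refine le_trans ?_ h1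
  obtain ⟨b, hb⟩ := h i hi
  have hbd : BddAbove (range fun x => ⨆ (_ : x ∈ s), ‖iteratedFDerivWithin ℝ i f s x‖) := by
    refine ⟨max b 0, ?_⟩
    rintro _ ⟨y, rfl⟩
    by_cases hy : y ∈ s
    · simp only [hy, ciSup_unique]
      exact (hb ⟨y, hy, rfl⟩).trans (le_max_left _ _)
    · simp [hy]
  have := le_ciSup hbd x
  simpa [hx] using this

theorem CkSupNorm_nonneg (k : ℕ) (f : E → F) (s : Set E) : 0 ≤ CkSupNorm k f s :=
  Finset.sum_nonneg fun _ _ => Real.iSup_nonneg fun _ => Real.iSup_nonneg fun _ => norm_nonneg _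

end BdLemmas

theorem contDiffOn_of_inv {E : Type} [NormedAddCommGroup E] [NormedSpace ℝ E] [CompleteSpace E]
    {k : ℕ} {U : Set E} {M Minv : E → (E →L[ℝ] E)} (hM : ContDiffOn ℝ k M U)
    (h : ∀ x ∈ U, (Minv x).comp (M x) = ContinuousLinearMap.id ℝ _ ∧
          (M x).comp (Minv x) = ContinuousLinearMap.id ℝ _) : ContDiffOn ℝ k Minv U := by
  let u : ∀ x ∈ U, (E →L[ℝ] E)ˣ := fun x hx => ⟨M x, Minv x, (h x hx).2, (h x hx).1⟩
  have h1 : ContDiffOn ℝ k (fun x => Ring.inverse (M x)) U := fun x hx => 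
    (contDiffAt_ringInverse ℝ (u x hx)).comp_contDiffWithinAt x (hM x hx)
  refine h1.congr fun x hx => ?_
  exact (Ring.inverse_unit (u x hx)).symm

section Gam
variable {E : Type} [NormedAddCommGroup E] [InnerProductSpace ℝ E] [FiniteDimensional ℝ E]

noncomputable def adjL : (E →L[ℝ] E) →L[ℝ] (E →L[ℝ] E) :=
  haveI : CompleteSpace E := FiniteDimensional.complete ℝ E
  LinearMap.toContinuousLinearMap
    { toFun := fun A => ContinuousLinearMap.adjoint A
      map_add' := fun A B => by simp
      map_smul' := fun c A => by simp }

theorem adjL_inner (A : E →L[ℝ] E) (u w : E) : ⟪adjL A u, w⟫ = ⟪u, A w⟫ := by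
  haveI : CompleteSpace E := FiniteDimensional.complete ℝ E
  exact ContinuousLinearMap.adjoint_inner_left A w u

/-- left composition `T ↦ (u ↦ A ∘ T u)` -/
noncomputable def lcomp : (E →L[ℝ] E) →L[ℝ] (E →L[ℝ] E →L[ℝ] E) →L[ℝ] (E →L[ℝ] E →L[ℝ] E) :=
  (ContinuousLinearMap.compL ℝ E (E →L[ℝ] E) (E →L[ℝ] E)).comp (ContinuousLinearMap.compL ℝ E E E)

theorem lcomp_apply (A : E →L[ℝ] E) (T : E →L[ℝ] E →L[ℝ] E) (u v : E) :
    lcomp A T u v = A (T u v) := rfl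

noncomputable def rcomp : (E →L[ℝ] E) →L[ℝ] (E →L[ℝ] E →L[ℝ] E) →L[ℝ] (E →L[ℝ] E →L[ℝ] E) :=
  (ContinuousLinearMap.compL ℝ E (E →L[ℝ] E) (E →L[ℝ] E)).comp
    (ContinuousLinearMap.compL ℝ E E E).flip

theorem rcomp_apply (A : E →L[ℝ] E) (T : E →L[ℝ] E →L[ℝ] E) (u v : E) :
    rcomp A T u v = T u (A v) := rfl

noncomputable def pcomp : (E →L[ℝ] E →L[ℝ] E) →L[ℝ] (E →L[ℝ] E) →L[ℝ] (E →L[ℝ] E →L[ℝ] E) :=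
  ContinuousLinearMap.compL ℝ E E (E →L[ℝ] E)

theorem pcomp_apply (A : E →L[ℝ] E) (T : E →L[ℝ] E →L[ℝ] E) (u v : E) :
    pcomp T A u v = T (A u) v := rfl

noncomputable def flipC : (E →L[ℝ] E →L[ℝ] E) →L[ℝ] (E →L[ℝ] E →L[ℝ] E) :=
  (ContinuousLinearMap.flipₗᵢ ℝ E E E).toContinuousLinearEquiv.toContinuousLinearMap

theorem flipC_apply (T : E →L[ℝ] E →L[ℝ] E) (u v : E) : flipC T u v = T v u := rfl

noncomputable def adj2 : (E →L[ℝ] E →L[ℝ] E) →L[ℝ] (E →L[ℝ] E →L[ℝ] E) :=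
  ContinuousLinearMap.compL ℝ E (E →L[ℝ] E) (E →L[ℝ] E) adjL

theorem adj2_apply (T : E →L[ℝ] E →L[ℝ] E) (u v : E) : adj2 T u v = adjL (T u) v := rfl

/-- lowered Christoffel symbol -/
noncomputable def gam : (E →L[ℝ] E →L[ℝ] E) →L[ℝ] (E →L[ℝ] E →L[ℝ] E) :=
  (1/2 : ℝ) • (adj2 + flipC.comp adj2 - flipC.comp (adj2.comp flipC))

theorem gam_inner (T : E →L[ℝ] E →L[ℝ] E) (u v w : E) :
    ⟪gam T u v, w⟫ = (1/2 : ℝ) * (⟪v, T u w⟫ + ⟪u, T v w⟫ - ⟪u, T w v⟫) := by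
  have : gam T u v = (1/2 : ℝ) • (adjL (T u) v + adjL (T v) u - adjL (flipC T v) u) := rfl
  rw [this, real_inner_smul_left, inner_sub_left, inner_add_left]
  simp only [adjL_inner, flipC_apply]

theorem alg_id (A N M Minv Ninv : E →L[ℝ] E) (D2 DM DN : E →L[ℝ] E →L[ℝ] E)
    (hsym : ∀ u v, D2 u v = D2 v u)
    (hM : ∀ u v, ⟪u, M v⟫ = ⟪M u, v⟫) (hMp : ∀ v, v ≠ 0 → (0 : ℝ) < ⟪v, M v⟫)
    (hN : ∀ u v, ⟪u, N v⟫ = ⟪N u, v⟫)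
    (hMi : M.comp Minv = ContinuousLinearMap.id ℝ _)
    (hNi : N.comp Ninv = ContinuousLinearMap.id ℝ _)
    (hiso : ∀ u v, ⟪A u, N (A v)⟫ = ⟪u, M v⟫)
    (hD : ∀ w u v, ⟪D2 w u, N (A v)⟫ + ⟪A u, N (D2 w v)⟫ + ⟪A u, DN (A w) (A v)⟫
      = ⟪u, DM w v⟫) :
    D2 = lcomp A (lcomp Minv (gam DM)) - rcomp A (pcomp (lcomp Ninv (gam DN)) A) := by
  have hinj : Function.Injective A := by
    rw [injective_iff_map_eq_zero]
    intro v hv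
    by_contra h
    have := hMp v h
    rw [← hiso, hv] at this
    simp at this
  have hsurj : Function.Surjective A :=
    (LinearMap.injective_iff_surjective (f := (A : E →ₗ[ℝ] E))).1 hinj
  have hNs : Function.Surjective N := fun y => ⟨Ninv y, by
    simpa using congrArg (fun L : E →L[ℝ] E => L y) hNi⟩
  have hMM : ∀ y, M (Minv y) = y := fun y => by
    simpa using congrArg (fun L : E →L[ℝ] E => L y) hMi
  have hNN : ∀ y, N (Ninv y) = y := fun y => by
    simpa using congrArg (fun L : E →L[ℝ] E => L y) hNi
  ext1 u
  ext1 v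
  apply ext_inner_right ℝ
  intro y
  obtain ⟨z, rfl⟩ := hNs y
  obtain ⟨w, rfl⟩ := hsurj z
  have e : (lcomp A (lcomp Minv (gam DM)) - rcomp A (pcomp (lcomp Ninv (gam DN)) A)) u v
    = A (Minv (gam DM u v)) - Ninv (gam DN (A u) (A v)) := rfl
  rw [e, inner_sub_left, hiso, hM, hMM, hN (Ninv _), hNN, gam_inner, gam_inner]
  have h1 := hD u v w
  have h2 := hD v u w
  have h3 := hD w u v
  rw [hsym v u] at h2
  rw [hsym w u, hsym w v] at h3
  have s1 : ⟪A v, N (D2 u w)⟫ = ⟪D2 u w, N (A v)⟫ := by rw [hN, real_inner_comm]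
  linarith

end Gam

theorem isom_deriv_id {E : Type} [NormedAddCommGroup E] [InnerProductSpace ℝ E]
    [FiniteDimensional ℝ E] {U V : Set E} (hU : IsOpen U) (hV : IsOpen V)
    {φ : E → E} (hφ : ContDiffOn ℝ 2 φ U) (hUV : MapsTo φ U V) {M N : E → (E →L[ℝ] E)}
    (hM : ContDiffOn ℝ 1 M U) (hN : ContDiffOn ℝ 1 N V)
    (hiso : ∀ x ∈ U, ∀ u v, ⟪fderiv ℝ φ x u, N (φ x) (fderiv ℝ φ x v)⟫ = ⟪u, M x v⟫)
    {x : E} (hx : x ∈ U) (w u v : E) :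
    ⟪fderiv ℝ (fderiv ℝ φ) x w u, N (φ x) (fderiv ℝ φ x v)⟫
      + ⟪fderiv ℝ φ x u, N (φ x) (fderiv ℝ (fderiv ℝ φ) x w v)⟫
      + ⟪fderiv ℝ φ x u, fderiv ℝ N (φ x) (fderiv ℝ φ x w) (fderiv ℝ φ x v)⟫
      = ⟪u, fderiv ℝ M x w v⟫ := by
  have hUx := hU.mem_nhds hx
  have hVx := hV.mem_nhds (hUV hx)
  have dφ : HasFDerivAt φ (fderiv ℝ φ x) x :=
    ((hφ.contDiffAt hUx).differentiableAt (by norm_num)).hasFDerivAt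
  have d2 : HasFDerivAt (fderiv ℝ φ) (fderiv ℝ (fderiv ℝ φ) x) x :=
    (((hφ.fderiv_of_isOpen hU (m := 1) (by norm_num)).contDiffAt hUx).differentiableAt
      (by norm_num)).hasFDerivAt
  have dM : HasFDerivAt M (fderiv ℝ M x) x :=
    ((hM.contDiffAt hUx).differentiableAt (by norm_num)).hasFDerivAt
  have dN : HasFDerivAt N (fderiv ℝ N (φ x)) (φ x) :=
    ((hN.contDiffAt hVx).differentiableAt (by norm_num)).hasFDerivAt
  have dNφ := dN.comp x dφ
  have du := d2.clm_apply (hasFDerivAt_const u x)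
  have dv := d2.clm_apply (hasFDerivAt_const v x)
  have l := du.inner ℝ (dNφ.clm_apply dv)
  have r := (hasFDerivAt_const u x).inner ℝ (dM.clm_apply (hasFDerivAt_const v x))
  have r' := r.congr_of_eventuallyEq (f₁ := fun y => ⟪fderiv ℝ φ y u, N (φ y) (fderiv ℝ φ y v)⟫)
    (Filter.eventually_of_mem hUx fun y hy => hiso y hy u v)
  have := congrArg (fun L : E →L[ℝ] ℝ => L w) (l.unique r')
  simp [inner_add_right] at this
  linarith

structure Config {E : Type} [NormedAddCommGroup E] [InnerProductSpace ℝ E]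
    (k : ℕ) (B : ℝ) (U V : Set E) (φ : E → E) (M Minv N Ninv : E → (E →L[ℝ] E)) : Prop where
  hU : IsOpen U
  hV : IsOpen V
  hφ : ContDiffOn ℝ k φ U
  hUV : MapsTo φ U V
  hM : ∀ x ∈ U, (∀ u v, ⟪u, M x v⟫ = ⟪M x u, v⟫) ∧ ∀ v, v ≠ 0 → (0 : ℝ) < ⟪v, M x v⟫
  hN : ∀ y ∈ V, (∀ u v, ⟪u, N y v⟫ = ⟪N y u, v⟫) ∧ ∀ v, v ≠ 0 → (0 : ℝ) < ⟪v, N y v⟫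
  hMi : ∀ x ∈ U, (M x).comp (Minv x) = ContinuousLinearMap.id ℝ _
  hNi : ∀ y ∈ V, (N y).comp (Ninv y) = ContinuousLinearMap.id ℝ _
  hiso : ∀ x ∈ U, ∀ u v, ⟪fderiv ℝ φ x u, N (φ x) (fderiv ℝ φ x v)⟫ = ⟪u, M x v⟫
  bM : Bd k M U B
  bMi : Bd k Minv U B
  bN : Bd k N V B
  bNi : Bd k Ninv V B

section Main
set_option maxSynthPendingDepth 3
variable {E : Type} [NormedAddCommGroup E] [InnerProductSpace ℝ E] [FiniteDimensional ℝ E]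

theorem Config.first {k : ℕ} {B : ℝ} (hB : 0 < B) {U V : Set E} {φ : E → E}
    {M Minv N Ninv : E → (E →L[ℝ] E)} (c : Config k B U V φ M Minv N Ninv) {x : E} (hx : x ∈ U) :
    ‖fderiv ℝ φ x‖ ≤ B := by
  have hV := c.hUV hx
  have hm : ‖M x‖ ≤ B := by simpa using c.bM.le 0 (Nat.zero_le _) x hx
  have hn : ‖Ninv (φ x)‖ ≤ B := by simpa using c.bNi.le 0 (Nat.zero_le _) _ hV
  refine ContinuousLinearMap.opNorm_le_bound _ hB.le fun v => ?_
  set y := fderiv ℝ φ x v with hy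
  set P := N (φ x) with hP
  set Q := Ninv (φ x) with hQ
  have hPQ : ∀ z, P (Q z) = z := fun z => by
    simpa using congrArg (fun L : E →L[ℝ] E => L z) (c.hNi _ hV)
  have hnn : ∀ z, 0 ≤ ⟪z, P z⟫ := fun z => by
    by_cases hz : z = 0
    · simp [hz]
    · exact ((c.hN _ hV).2 z hz).le
  have h1 := hnn (B • y - Q y)
  have h2 : ⟪B • y - Q y, P (B • y - Q y)⟫ = B ^ 2 * ⟪y, P y⟫ - 2 * B * ⟪y, y⟫ + ⟪Q y, y⟫ := by
    have : ⟪Q y, P y⟫ = ⟪y, y⟫ := by rw [(c.hN _ hV).1, hPQ]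
    simp only [map_sub, map_smul, inner_sub_left, inner_sub_right, real_inner_smul_left,
      real_inner_smul_right, hPQ, this]
    ring
  have h3 : ⟪Q y, y⟫ ≤ B * ⟪y, y⟫ := by
    calc ⟪Q y, y⟫ ≤ ‖Q y‖ * ‖y‖ := real_inner_le_norm _ _
      _ ≤ (B * ‖y‖) * ‖y‖ := by
        gcongr
        exact Q.le_of_opNorm_le hn y
      _ = _ := by rw [real_inner_self_eq_norm_sq]; ring
  have h4 : ⟪y, P y⟫ ≤ B * ‖v‖ ^ 2 := by
    rw [c.hiso x hx v v]
    calc ⟪v, M x v⟫ ≤ ‖v‖ * ‖M x v‖ := real_inner_le_norm _ _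
      _ ≤ ‖v‖ * (B * ‖v‖) := by
        gcongr
        exact (M x).le_of_opNorm_le hm v
      _ = _ := by ring
  rw [real_inner_self_eq_norm_sq] at h2 h3
  have h5 : ‖y‖ ^ 2 ≤ B * ⟪y, P y⟫ := by
    have : B * ‖y‖ ^ 2 ≤ B * (B * ⟪y, P y⟫) := by nlinarith
    exact le_of_mul_le_mul_left this hB
  have h6 : ‖y‖ ^ 2 ≤ (B * ‖v‖) ^ 2 := by nlinarith
  exact le_of_sq_le_sq h6 (by positivity)

theorem Config.second {k : ℕ} (hk : 2 ≤ k) {B : ℝ} {U V : Set E} {φ : E → E}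
    {M Minv N Ninv : E → (E →L[ℝ] E)} (c : Config k B U V φ M Minv N Ninv) :
    EqOn (fderivWithin ℝ (fderivWithin ℝ φ U) U) (fun x =>
      lcomp (fderivWithin ℝ φ U x) (lcomp (Minv x) (gam (fderivWithin ℝ M U x))) -
      rcomp (fderivWithin ℝ φ U x) (pcomp (lcomp (Ninv (φ x)) (gam (fderivWithin ℝ N V (φ x))))
        (fderivWithin ℝ φ U x))) U := by
  intro x hx
  have hV := c.hUV hx
  have h2 : ContDiffOn ℝ 2 φ U := c.hφ.of_le (by exact_mod_cast hk)
  have e2 : fderivWithin ℝ (fderivWithin ℝ φ U) U x = fderiv ℝ (fderiv ℝ φ) x := by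
    rw [fderivWithin_congr (fun y hy => fderivWithin_of_isOpen c.hU hy)
      (fderivWithin_of_isOpen c.hU hx), fderivWithin_of_isOpen c.hU hx]
  simp only [e2, fderivWithin_of_isOpen c.hU hx, fderivWithin_of_isOpen c.hV hV]
  refine alg_id _ (N (φ x)) (M x) _ _ _ _ _ ?_ (c.hM x hx).1 (c.hM x hx).2 (c.hN _ hV).1
    (c.hMi x hx) (c.hNi _ hV) (c.hiso x hx) ?_
  · exact (h2.contDiffAt (c.hU.mem_nhds hx)).isSymmSndFDerivAt (by simp)
  · exact isom_deriv_id c.hU c.hV h2 c.hUV (c.bM.cd.of_le (by exact_mod_cast (by omega : 1 ≤ k)))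
      (c.bN.cd.of_le (by exact_mod_cast (by omega : 1 ≤ k))) c.hiso hx

theorem Config.all {k : ℕ} {B : ℝ} (hB : 0 < B) (j : ℕ) (hj : j + 1 ≤ k) :
    ∃ C : ℝ, ∀ (U V : Set E) (φ : E → E) (M Minv N Ninv : E → (E →L[ℝ] E)),
      Config k B U V φ M Minv N Ninv → Bd j (fderivWithin ℝ φ U) U C := by
  induction j with
  | zero =>
    refine ⟨B, fun U V φ M Minv N Ninv c => ⟨?_, ?_⟩⟩
    · exact c.hφ.fderivWithin c.hU.uniqueDiffOn (by exact_mod_cast hj)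
    · intro i hi x hx
      obtain rfl : i = 0 := by omega
      rw [norm_iteratedFDerivWithin_zero, fderivWithin_of_isOpen c.hU hx]
      exact c.first hB hx
  | succ j ih =>
    obtain ⟨C, hC⟩ := ih (by omega)
    let b := ‖lcomp (E := E)‖ * (2 ^ j * (B * (‖gam (E := E)‖ * B)))
    let K1 := ‖lcomp (E := E)‖ * (2 ^ j * (C * b))
    let K2 := ‖rcomp (E := E)‖ * (2 ^ j * (C *
      (‖pcomp (E := E)‖ * (2 ^ j * ((j.factorial * b * (max 1 C) ^ j) * C)))))
    refine ⟨max B (K1 + K2), fun U V φ M Minv N Ninv c => ?_⟩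
    · have hA := hC _ _ _ _ _ _ _ c
      refine Bd.of_fderivWithin c.hU (c.hφ.fderivWithin c.hU.uniqueDiffOn (by exact_mod_cast hj))
        (Bd.congr ?_ (c.second (by omega))) ?_
      · have g1 := (Bd.fderivWithin c.hU (c.bM.mono (m' := j + 1) (by omega))).clm c.hU (gam (E := E))
        have g2 := (c.bMi.mono (m' := j) (by omega)).bilin c.hU (lcomp (E := E)) g1
        have g3 := hA.bilin c.hU (lcomp (E := E)) g2
        have n1 := (Bd.fderivWithin c.hV (c.bN.mono (m' := j + 1) (by omega))).clm c.hV (gam (E := E))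
        have n2 := (c.bNi.mono (m' := j) (by omega)).bilin c.hV (lcomp (E := E)) n1
        have n3 := Bd.comp c.hU c.hV c.hUV n2
          (c.hφ.of_le (by exact_mod_cast (by omega : j + 1 ≤ k))) hA
        have n4 := n3.bilin c.hU (pcomp (E := E)) hA
        have n5 := hA.bilin c.hU (rcomp (E := E)) n4
        exact g3.sub c.hU n5
      · intro x hx
        rw [fderivWithin_of_isOpen c.hU hx]
        exact c.first hB hx

end Main

/-- For every dimension `n ≥ 1` and every `k ≥ 1` there is a function `C_k` of four
real variables such that: whenever `φ : U → V` is a `C^k` diffeomorphism between open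
subsets of `ℝⁿ` pulling back the metric represented by the symmetric positive definite
operator field `N` to the one represented by `M` (`Dφ(x)ᵀ N(φ x) Dφ(x) = M(x)`), and the
`C^k` norms of `M`, `M⁻¹`, `N`, `N⁻¹` are finite, then
`sup_{x ∈ U} ‖D^kφ(x)‖ ≤ C_k(‖M‖_{C^k(U)}, ‖M⁻¹‖_{C^k(U)}, ‖N‖_{C^k(V)}, ‖N⁻¹‖_{C^k(V)})`. -/
theorem exists_bound_iteratedFDeriv_of_isometry (n : ℕ) (hn : 1 ≤ n) (k : ℕ) (hk : 1 ≤ k) :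
    ∃ C : ℝ → ℝ → ℝ → ℝ → ℝ,
      ∀ (U V : Set (EuclideanSpace ℝ (Fin n))), IsOpen U → IsOpen V →
      ∀ φ ψ : EuclideanSpace ℝ (Fin n) → EuclideanSpace ℝ (Fin n),
        ContDiffOn ℝ k φ U → ContDiffOn ℝ k ψ V →
        Set.MapsTo φ U V → Set.MapsTo ψ V U → Set.InvOn ψ φ U V →
      ∀ M Minv N Ninv : EuclideanSpace ℝ (Fin n) →
          (EuclideanSpace ℝ (Fin n) →L[ℝ] EuclideanSpace ℝ (Fin n)),
        ContDiffOn ℝ k M U → ContDiffOn ℝ k N V →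
        -- `M` is symmetric positive definite on `U`
        (∀ x ∈ U, (∀ u v, ⟪u, M x v⟫ = ⟪M x u, v⟫) ∧
          ∀ v, v ≠ 0 → (0 : ℝ) < ⟪v, M x v⟫) →
        -- `N` is symmetric positive definite on `V`
        (∀ y ∈ V, (∀ u v, ⟪u, N y v⟫ = ⟪N y u, v⟫) ∧
          ∀ v, v ≠ 0 → (0 : ℝ) < ⟪v, N y v⟫) →
        -- `Minv` and `Ninv` are the pointwise inverses of `M` and `N`
        (∀ x ∈ U, (Minv x).comp (M x) = ContinuousLinearMap.id ℝ _ ∧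
          (M x).comp (Minv x) = ContinuousLinearMap.id ℝ _) →
        (∀ y ∈ V, (Ninv y).comp (N y) = ContinuousLinearMap.id ℝ _ ∧
          (N y).comp (Ninv y) = ContinuousLinearMap.id ℝ _) →
        -- the isometry condition `Dφ(x)ᵀ ⬝ N(φ(x)) ⬝ Dφ(x) = M(x)` on `U`
        (∀ x ∈ U, ∀ u v, ⟪fderiv ℝ φ x u, N (φ x) (fderiv ℝ φ x v)⟫ = ⟪u, M x v⟫) →
        -- finiteness of the `C^k` norms
        CkBdd k M U → CkBdd k Minv U → CkBdd k N V → CkBdd k Ninv V →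
        ∀ x ∈ U, ‖iteratedFDerivWithin ℝ k φ U x‖ ≤
          C (CkSupNorm k M U) (CkSupNorm k Minv U) (CkSupNorm k N V) (CkSupNorm k Ninv V) := by
  obtain ⟨j, rfl⟩ : ∃ j, k = j + 1 := ⟨k - 1, by omega⟩
  have key : ∀ B : ℝ, ∃ C : ℝ, 0 < B → ∀ (U V : Set (EuclideanSpace ℝ (Fin n)))
      (φ : EuclideanSpace ℝ (Fin n) → EuclideanSpace ℝ (Fin n))
      (M Minv N Ninv : EuclideanSpace ℝ (Fin n) →
          (EuclideanSpace ℝ (Fin n) →L[ℝ] EuclideanSpace ℝ (Fin n))),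
      Config (j + 1) B U V φ M Minv N Ninv → Bd j (fderivWithin ℝ φ U) U C := by
    intro B
    by_cases hB : 0 < B
    · obtain ⟨C, hC⟩ := Config.all (E := EuclideanSpace ℝ (Fin n)) hB j (le_refl (j + 1))
      exact ⟨C, fun _ => hC⟩
    · exact ⟨0, fun h => absurd h hB⟩
  choose C hC using key
  refine ⟨fun a b c d => C (a + b + c + d + 1), ?_⟩
  intro U V hU hV φ ψ hφ _ hUV _ _ M Minv N Ninv hM hN hMp hNp hMi hNi hiso bM bMi bN bNi x hx
  have p1 := CkSupNorm_nonneg (j + 1) M U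
  have p2 := CkSupNorm_nonneg (j + 1) Minv U
  have p3 := CkSupNorm_nonneg (j + 1) N V
  have p4 := CkSupNorm_nonneg (j + 1) Ninv V
  rw [← norm_iteratedFDerivWithin_fderivWithin hU.uniqueDiffOn hx]
  refine (hC _ (by linarith) U V φ M Minv N Ninv ?_).le j le_rfl x hx
  exact
    { hU := hU, hV := hV, hφ := hφ, hUV := hUV, hM := hMp, hN := hNp
      hMi := fun x hx => (hMi x hx).2
      hNi := fun x hx => (hNi x hx).2
      hiso := hiso
      bM := Bd.of_CkBdd hM bM (by linarith)
      bMi := Bd.of_CkBdd (contDiffOn_of_inv hM hMi) bMi (by linarith)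
      bN := Bd.of_CkBdd hN bN (by linarith)
      bNi := Bd.of_CkBdd (contDiffOn_of_inv hN hNi) bNi (by linarith) }
end

section
/- Let m, p ≥ 1, let K > 0 and B > 0, and let δ > 0 satisfy δ ≤ B / (K·√(1 + B²)). Let f : B_δ(0) → ℝ^p be a C² function on the open Euclidean ball of radius δ about 0 in ℝ^m such that f(0) = 0, Df(0) = 0, and ‖D²f(x)‖ ≤ K·(1 + ‖Df(x)‖²)^{3/2} for all x ∈ B_δ(0). Then for all x ∈ B_δ(0): ‖Df(x)‖ ≤ B and ‖f(x)‖ ≤ B·‖x‖. -/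
open Set Metric

lemma barrier_deriv (c t : ℝ) (h : 0 < 1 - (c * t) ^ 2) :
    HasDerivAt (fun t => c * t / Real.sqrt (1 - (c * t) ^ 2))
      (c * (1 + (c * t / Real.sqrt (1 - (c * t) ^ 2)) ^ 2) ^ ((3 : ℝ) / 2)) t := by
  have hs : 0 < Real.sqrt (1 - (c * t) ^ 2) := Real.sqrt_pos.2 h
  have h1 : HasDerivAt (fun t : ℝ => c * t) c t := by
    simpa using (hasDerivAt_id t).const_mul c
  have h2 := ((h1.pow 2).const_sub 1).sqrt h.ne'
  have h3 := h1.div h2 hs.ne'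
  refine h3.congr_deriv ?_
  have hsq : Real.sqrt (1 - (c * t) ^ 2) ^ 2 = 1 - (c * t) ^ 2 := Real.sq_sqrt h.le
  simp only [Pi.pow_apply]
  set s := Real.sqrt (1 - (c * t) ^ 2) with hsdef
  have e : 1 + (c * t / s) ^ 2 = (s⁻¹) ^ (2 : ℝ) := by
    rw [Real.rpow_two]
    field_simp
    linarith
  rw [e, ← Real.rpow_mul (by positivity)]
  have : (2 : ℝ) * (3 / 2) = (3 : ℕ) := by norm_num
  rw [this, Real.rpow_natCast]
  field_simp
  push_cast
  have e3 : s ^ 2 + c ^ 2 * t ^ 2 = 1 := by rw [hsq]; ring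
  norm_num
  left
  linear_combination 2 * e3

/-- Solving the differential inequality `‖D²f‖ ≤ K (1 + ‖Df‖²)^{3/2}` with initial
conditions `f(0) = 0`, `Df(0) = 0`: on a ball of radius `δ ≤ B / (K √(1 + B²))` one has
`‖Df(x)‖ ≤ B` and `‖f(x)‖ ≤ B ‖x‖`. -/
theorem gradient_bound_of_second_derivative_bound
    {m p : ℕ} (hm : 1 ≤ m) (hp : 1 ≤ p) (K B δ : ℝ)
    (hK : 0 < K) (hB : 0 < B) (hδ : 0 < δ)
    (hδle : δ ≤ B / (K * Real.sqrt (1 + B ^ 2)))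
    (f : EuclideanSpace ℝ (Fin m) → EuclideanSpace ℝ (Fin p))
    (hf : ContDiffOn ℝ 2 f (ball (0 : EuclideanSpace ℝ (Fin m)) δ))
    (hf0 : f 0 = 0)
    (hDf0 : fderivWithin ℝ f (ball (0 : EuclideanSpace ℝ (Fin m)) δ) 0 = 0)
    (hD2f : ∀ x ∈ ball (0 : EuclideanSpace ℝ (Fin m)) δ,
      ‖iteratedFDerivWithin ℝ 2 f (ball (0 : EuclideanSpace ℝ (Fin m)) δ) x‖ ≤
        K * (1 + ‖fderivWithin ℝ f (ball (0 : EuclideanSpace ℝ (Fin m)) δ) x‖ ^ 2)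
          ^ ((3 : ℝ) / 2)) :
    ∀ x ∈ ball (0 : EuclideanSpace ℝ (Fin m)) δ,
      ‖fderivWithin ℝ f (ball (0 : EuclideanSpace ℝ (Fin m)) δ) x‖ ≤ B ∧
      ‖f x‖ ≤ B * ‖x‖ := by
  have hKB : K * δ ≤ B / Real.sqrt (1 + B ^ 2) := by
    have : B / Real.sqrt (1 + B ^ 2) = K * (B / (K * Real.sqrt (1 + B ^ 2))) := by
      field_simp
    rw [this]
    gcongr
  have hq : 0 < Real.sqrt (1 + B ^ 2) := Real.sqrt_pos.2 (by positivity)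
  have hq2 : Real.sqrt (1 + B ^ 2) ^ 2 = 1 + B ^ 2 := Real.sq_sqrt (by positivity)
  obtain ⟨c, hc⟩ : ∃ c, c = K * δ := ⟨_, rfl⟩
  rw [← hc] at hKB
  have hc0 : 0 < c := by rw [hc]; positivity
  have hcsq : c ^ 2 * (1 + B ^ 2) ≤ B ^ 2 := by
    have h1 : c * Real.sqrt (1 + B ^ 2) ≤ B := (le_div_iff₀ hq).1 hKB
    have h2 : (c * Real.sqrt (1 + B ^ 2)) ^ 2 ≤ B ^ 2 := by gcongr
    rwa [mul_pow, hq2] at h2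
  have hc1 : c ^ 2 < 1 := by
    by_contra hcon
    push Not at hcon
    nlinarith [sq_nonneg B]
  have hopen : IsOpen (ball (0 : EuclideanSpace ℝ (Fin m)) δ) := isOpen_ball
  have hu := hopen.uniqueDiffOn (𝕜 := ℝ)
  have hG : DifferentiableOn ℝ (fderivWithin ℝ f (ball 0 δ)) (ball 0 δ) :=
    (hf.fderivWithin hu (m := 1) (by norm_num)).differentiableOn (by norm_num)
  have hD2 : ∀ x ∈ ball (0 : EuclideanSpace ℝ (Fin m)) δ,
      ‖fderivWithin ℝ (fderivWithin ℝ f (ball 0 δ)) (ball 0 δ) x‖ ≤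
        K * (1 + ‖fderivWithin ℝ f (ball 0 δ) x‖ ^ 2) ^ ((3 : ℝ) / 2) := by
    intro x hx
    refine le_trans (le_of_eq ?_) (hD2f x hx)
    rw [← norm_iteratedFDerivWithin_one _ (hu x hx),
      norm_iteratedFDerivWithin_fderivWithin hu hx]
  have key : ∀ x ∈ ball (0 : EuclideanSpace ℝ (Fin m)) δ,
      ‖fderivWithin ℝ f (ball (0 : EuclideanSpace ℝ (Fin m)) δ) x‖ ≤ B := by
    intro x hx
    have hxn : ‖x‖ < δ := by simpa using hx
    have hmem : ∀ t ∈ Icc (0 : ℝ) 1, t • x ∈ ball (0 : EuclideanSpace ℝ (Fin m)) δ := by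
      intro t ht
      rw [mem_ball_zero_iff, norm_smul, Real.norm_of_nonneg ht.1]
      nlinarith [norm_nonneg x, ht.2]
    have hd : ∀ t ∈ Icc (0 : ℝ) 1, HasDerivAt
        (fun t : ℝ => fderivWithin ℝ f (ball 0 δ) (t • x))
        (fderivWithin ℝ (fderivWithin ℝ f (ball 0 δ)) (ball 0 δ) (t • x) x) t := by
      intro t ht
      have h1 := (hG _ (hmem t ht)).hasFDerivWithinAt.hasFDerivAt
        (hopen.mem_nhds (hmem t ht))
      have h2 : HasDerivAt (fun t : ℝ => t • x) x t := by
        simpa using (hasDerivAt_id t).smul_const x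
      exact h1.comp_hasDerivAt t h2
    have hpos : ∀ t ∈ Icc (0 : ℝ) 1, 0 < 1 - (c * t) ^ 2 := by
      intro t ht
      have : t ^ 2 ≤ 1 := pow_le_one₀ ht.1 ht.2
      nlinarith [sq_nonneg c]
    have main := image_norm_le_of_norm_deriv_right_lt_deriv_boundary'
      (a := (0 : ℝ)) (b := 1)
      (B := fun t => c * t / Real.sqrt (1 - (c * t) ^ 2))
      (fun t ht => (hd t ht).continuousAt.continuousWithinAt)
      (fun t ht => (hd t (Ico_subset_Icc_self ht)).hasDerivWithinAt)
      (by simp [hDf0])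
      (fun t ht => (barrier_deriv c t (hpos t ht)).continuousAt.continuousWithinAt)
      (fun t ht => (barrier_deriv c t (hpos t (Ico_subset_Icc_self ht))).hasDerivWithinAt)
      (by
        intro t ht heq
        have ht' := Ico_subset_Icc_self ht
        have hb := hD2 _ (hmem t ht')
        rw [← heq]
        set R := (1 + ‖fderivWithin ℝ f (ball 0 δ) (t • x)‖ ^ 2) ^ ((3 : ℝ) / 2) with hR
        have hRpos : 0 < R := by positivity
        calc _ ≤ _ := ContinuousLinearMap.le_opNorm _ _
          _ ≤ (K * R) * ‖x‖ := by gcongr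
          _ < (K * R) * δ := by gcongr
          _ = c * R := by rw [hc]; ring)
      (right_mem_Icc.2 zero_le_one)
    simp only [one_smul, mul_one] at main
    refine main.trans ?_
    have hs : 0 < Real.sqrt (1 - c ^ 2) := Real.sqrt_pos.2 (by linarith)
    rw [div_le_iff₀ hs]
    refine (sq_le_sq₀ hc0.le (by positivity)).1 ?_
    rw [mul_pow, Real.sq_sqrt (by linarith)]
    linarith
  intro x hx
  refine ⟨key x hx, ?_⟩
  have := (convex_ball (0 : EuclideanSpace ℝ (Fin m)) δ).norm_image_sub_le_of_norm_fderivWithin_le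
    (hf.differentiableOn (by norm_num)) key (mem_ball_self hδ) hx
  simpa [hf0] using this
end

section
/- Let Ω ⊆ ℝ^m and Ω' ⊆ ℝ^n, let α ∈ (0,1] and β ∈ (0,α). Let f : Ω' → ℝ^d have finite α-Hölder seminorm, and let g, g' : Ω → ℝ^n be bounded maps with finite 1-Hölder (Lipschitz) seminorm such that g(Ω) ⊆ Ω' and g'(Ω) ⊆ Ω'. Then ‖f∘g − f∘g'‖_{Lip^β(Ω)} ≤ 2^{1−β/α} · ‖f‖_{Lip^α(Ω')} · ‖g − g'‖_{C⁰(Ω)}^{α−β} · (‖g‖_{Lip¹(Ω)}^α + ‖g'‖_{Lip¹(Ω)}^α)^{β/α}. -/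
open scoped ENNReal

/-- The `α`-Hölder seminorm of a map on a set:
`‖f‖_{Lip^α(s)} = sup_{x ≠ y ∈ s} dist(f x, f y) / dist(x,y)^α` (as an extended real). -/
noncomputable def eHolderSemi {X Y : Type*} [PseudoEMetricSpace X] [PseudoEMetricSpace Y]
    (α : ℝ) (f : X → Y) (s : Set X) : ℝ≥0∞ :=
  ⨆ (x : X) (_ : x ∈ s) (y : X) (_ : y ∈ s) (_ : x ≠ y), edist (f x) (f y) / edist x y ^ α

/-- The sup norm `‖f‖_{C⁰(s)} = sup_{x ∈ s} ‖f x‖` (as an extended real). -/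
noncomputable def eSupNorm {X Y : Type*} [NNNorm Y] (f : X → Y) (s : Set X) : ℝ≥0∞ :=
  ⨆ (x : X) (_ : x ∈ s), (‖f x‖₊ : ℝ≥0∞)

theorem aux_edist_le {X Y : Type*} [MetricSpace X] [PseudoEMetricSpace Y]
    (α : ℝ) (f : X → Y) (s : Set X) {x y : X} (hx : x ∈ s) (hy : y ∈ s) :
    edist (f x) (f y) ≤ eHolderSemi α f s * edist x y ^ α := by
  by_cases h : x = y
  · subst h; simp
  · have h0 : edist x y ≠ 0 := by simpa using h
    have ht : edist x y ≠ ∞ := edist_ne_top x y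
    rw [← ENNReal.div_le_iff (by simp [ENNReal.rpow_eq_zero_iff, h0, ht])
      (by simp [ENNReal.rpow_eq_top_iff, h0, ht])]
    unfold eHolderSemi
    exact le_iSup_of_le x (le_iSup_of_le hx (le_iSup_of_le y (le_iSup_of_le hy
      (le_iSup_of_le h le_rfl))))

theorem aux_interp {D H S P r : ℝ≥0∞} {α β : ℝ} (hα0 : 0 < α) (hβ0 : 0 < β) (hβα : β < α)
    (h1 : D ≤ 2 * H * S ^ α) (h2 : D ≤ H * P * r ^ α) :
    D ≤ 2 ^ (1 - β / α) * H * S ^ (α - β) * P ^ (β / α) * r ^ β := by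
  have t0 : 0 ≤ β / α := by positivity
  have t1 : 0 ≤ 1 - β / α := by
    rw [sub_nonneg, div_le_one hα0]; exact hβα.le
  have e : ∀ z : ℝ≥0∞, z = z ^ (1 - β / α) * z ^ (β / α) := fun z => by
    rw [← ENNReal.rpow_add_of_nonneg _ _ t1 t0]; simp
  have e1 : α * (1 - β / α) = α - β := by field_simp
  have e2 : α * (β / α) = β := by field_simp
  calc D = D ^ (1 - β / α) * D ^ (β / α) := e D
    _ ≤ (2 * H * S ^ α) ^ (1 - β / α) * (H * P * r ^ α) ^ (β / α) := by gcongr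
    _ = 2 ^ (1 - β / α) * (H ^ (1 - β / α) * H ^ (β / α)) * S ^ (α - β) * P ^ (β / α) * r ^ β := by
      rw [ENNReal.mul_rpow_of_nonneg _ _ t1, ENNReal.mul_rpow_of_nonneg _ _ t1,
        ENNReal.mul_rpow_of_nonneg _ _ t0, ENNReal.mul_rpow_of_nonneg _ _ t0,
        ← ENNReal.rpow_mul, ← ENNReal.rpow_mul, e1, e2]
      ring
    _ = _ := by rw [← e H]

/-- Continuity estimate for composition (variation in the inner map): if `f` is
`α`-Hölder on `Ω'` and `g, g' : Ω → Ω'` are bounded and Lipschitz, then for `0 < β < α`,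
`‖f∘g − f∘g'‖_{Lip^β(Ω)} ≤ 2^{1−β/α} ‖f‖_{Lip^α(Ω')} ‖g−g'‖_{C⁰(Ω)}^{α−β}
  (‖g‖_{Lip¹(Ω)}^α + ‖g'‖_{Lip¹(Ω)}^α)^{β/α}`. -/
theorem eHolderSemi_comp_sub_comp_right_le {m n d : ℕ}
    (Ω : Set (EuclideanSpace ℝ (Fin m))) (Ω' : Set (EuclideanSpace ℝ (Fin n)))
    (α β : ℝ) (hα0 : 0 < α) (hα1 : α ≤ 1) (hβ0 : 0 < β) (hβα : β < α)
    (f : EuclideanSpace ℝ (Fin n) → EuclideanSpace ℝ (Fin d))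
    (g g' : EuclideanSpace ℝ (Fin m) → EuclideanSpace ℝ (Fin n))
    (hfα : eHolderSemi α f Ω' ≠ ∞)
    (hg0 : eSupNorm g Ω ≠ ∞) (hg1 : eHolderSemi 1 g Ω ≠ ∞)
    (hg'0 : eSupNorm g' Ω ≠ ∞) (hg'1 : eHolderSemi 1 g' Ω ≠ ∞)
    (hgmaps : Set.MapsTo g Ω Ω') (hg'maps : Set.MapsTo g' Ω Ω') :
    eHolderSemi β (fun x => f (g x) - f (g' x)) Ω ≤
      (2 : ℝ≥0∞) ^ (1 - β / α) * eHolderSemi α f Ω' *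
        eSupNorm (fun x => g x - g' x) Ω ^ (α - β) *
        (eHolderSemi 1 g Ω ^ α + eHolderSemi 1 g' Ω ^ α) ^ (β / α) := by
  have hS : ∀ z ∈ Ω, edist (g z) (g' z) ≤ eSupNorm (fun x => g x - g' x) Ω := fun z hz => by
    rw [edist_eq_enorm_sub]
    exact le_iSup₂_of_le (f := fun x (_ : x ∈ Ω) => ((‖g x - g' x‖₊ : NNReal) : ℝ≥0∞)) z hz le_rfl
  have hA : ∀ z ∈ Ω, edist (f (g z)) (f (g' z)) ≤
      eHolderSemi α f Ω' * eSupNorm (fun x => g x - g' x) Ω ^ α := fun z hz =>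
    (aux_edist_le α f Ω' (hgmaps hz) (hg'maps hz)).trans (by gcongr; exact hS z hz)
  have hB : ∀ k : EuclideanSpace ℝ (Fin m) → EuclideanSpace ℝ (Fin n), Set.MapsTo k Ω Ω' →
      ∀ x ∈ Ω, ∀ y ∈ Ω, edist (f (k x)) (f (k y)) ≤
        eHolderSemi α f Ω' * (eHolderSemi 1 k Ω ^ α * edist x y ^ α) := by
    intro k hk x hx y hy
    refine (aux_edist_le α f Ω' (hk hx) (hk hy)).trans ?_
    rw [← ENNReal.mul_rpow_of_nonneg _ _ hα0.le]
    gcongr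
    simpa using aux_edist_le 1 k Ω hx hy
  refine iSup_le fun x => iSup_le fun hx => iSup_le fun y => iSup_le fun hy => iSup_le fun _ => ?_
  refine ENNReal.div_le_of_le_mul (aux_interp hα0 hβ0 hβα ?_ ?_)
  · rw [edist_eq_enorm_sub]
    refine enorm_sub_le.trans ?_
    rw [← edist_eq_enorm_sub, ← edist_eq_enorm_sub]
    refine (add_le_add (hA x hx) (hA y hy)).trans (le_of_eq ?_)
    ring
  · have : edist (f (g x) - f (g' x)) (f (g y) - f (g' y)) ≤
        edist (f (g x)) (f (g y)) + edist (f (g' x)) (f (g' y)) := by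
      rw [edist_eq_enorm_sub, edist_eq_enorm_sub, edist_eq_enorm_sub, sub_sub_sub_comm]
      exact enorm_sub_le
    refine this.trans ((add_le_add (hB g hgmaps x hx y hy) (hB g' hg'maps x hx y hy)).trans
      (le_of_eq ?_))
    ring
end

section
/- Let Ω ⊆ ℝ^m and Ω' ⊆ ℝ^n, let α ∈ (0,1] and β ∈ (0,α). Let f, f' : Ω' → ℝ^d be bounded maps with finite α-Hölder seminorm, and let g : Ω → ℝ^n have finite 1-Hölder (Lipschitz) seminorm with g(Ω) ⊆ Ω'. Then ‖f∘g − f'∘g‖_{Lip^β(Ω)} ≤ 2^{1−β/α} · ‖f − f'‖_{C⁰(Ω')}^{1−β/α} · (‖f‖_{Lip^α(Ω')} + ‖f'‖_{Lip^α(Ω')})^{β/α} · ‖g‖_{Lip¹(Ω)}^β. -/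
open scoped ENNReal

theorem edist_le_eHolderSemi_aux {X Y : Type*} [MetricSpace X] [PseudoEMetricSpace Y]
    (α : ℝ) (hα : 0 ≤ α) (f : X → Y) (s : Set X) {x y : X} (hx : x ∈ s) (hy : y ∈ s) :
    edist (f x) (f y) ≤ eHolderSemi α f s * edist x y ^ α := by
  by_cases hxy : x = y
  · subst hxy
    simp
  · have h0 : edist x y ^ α ≠ 0 := by
      intro h
      rcases ENNReal.rpow_eq_zero_iff.1 h with h | h
      · exact hxy (edist_eq_zero.1 h.1)
      · exact edist_ne_top x y h.1
    have h1 : edist x y ^ α ≠ ∞ := ENNReal.rpow_ne_top_of_nonneg hα (edist_ne_top x y)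
    rw [← ENNReal.div_le_iff h0 h1]
    unfold eHolderSemi
    exact le_iSup_of_le x (le_iSup_of_le hx (le_iSup_of_le y (le_iSup_of_le hy
      (le_iSup_of_le hxy le_rfl))))

/-- Continuity estimate for composition (variation in the outer map): if `f, f'` are
bounded and `α`-Hölder on `Ω'` and `g : Ω → Ω'` is Lipschitz, then for `0 < β < α`,
`‖f∘g − f'∘g‖_{Lip^β(Ω)} ≤ 2^{1−β/α} ‖f−f'‖_{C⁰(Ω')}^{1−β/α}
  (‖f‖_{Lip^α(Ω')} + ‖f'‖_{Lip^α(Ω')})^{β/α} ‖g‖_{Lip¹(Ω)}^β`. -/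
theorem eHolderSemi_comp_sub_comp_left_le {m n d : ℕ}
    (Ω : Set (EuclideanSpace ℝ (Fin m))) (Ω' : Set (EuclideanSpace ℝ (Fin n)))
    (α β : ℝ) (hα0 : 0 < α) (hα1 : α ≤ 1) (hβ0 : 0 < β) (hβα : β < α)
    (f f' : EuclideanSpace ℝ (Fin n) → EuclideanSpace ℝ (Fin d))
    (g : EuclideanSpace ℝ (Fin m) → EuclideanSpace ℝ (Fin n))
    (hf0 : eSupNorm f Ω' ≠ ∞) (hfα : eHolderSemi α f Ω' ≠ ∞)
    (hf'0 : eSupNorm f' Ω' ≠ ∞) (hf'α : eHolderSemi α f' Ω' ≠ ∞)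
    (hg1 : eHolderSemi 1 g Ω ≠ ∞)
    (hgmaps : Set.MapsTo g Ω Ω') :
    eHolderSemi β (fun x => f (g x) - f' (g x)) Ω ≤
      (2 : ℝ≥0∞) ^ (1 - β / α) * eSupNorm (fun y => f y - f' y) Ω' ^ (1 - β / α) *
        (eHolderSemi α f Ω' + eHolderSemi α f' Ω') ^ (β / α) *
        eHolderSemi 1 g Ω ^ β := by
  have hθ0 : 0 < β / α := div_pos hβ0 hα0
  have hθ1 : 0 < 1 - β / α := by
    have := (div_lt_one hα0).2 hβα
    linarith
  conv_lhs => unfold eHolderSemi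
  refine iSup_le fun x => iSup_le fun hx => iSup_le fun y => iSup_le fun hy => iSup_le fun hxy => ?_
  refine ENNReal.div_le_of_le_mul ?_
  set S := eSupNorm (fun y => f y - f' y) Ω' with hS
  set D := edist (f (g x) - f' (g x)) (f (g y) - f' (g y)) with hD
  set H := eHolderSemi α f Ω' + eHolderSemi α f' Ω' with hH
  set L := eHolderSemi 1 g Ω with hL
  have hSle : ∀ z ∈ Ω', edist (f z - f' z) 0 ≤ S := by
    intro z hz
    rw [edist_zero_right, hS]
    unfold eSupNorm
    exact le_iSup_of_le z (le_iSup_of_le hz le_rfl)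
  have h1 : D ≤ 2 * S := by
    refine (edist_triangle_right _ _ 0).trans ?_
    rw [edist_comm (f (g y) - f' (g y)), two_mul]
    rw [edist_comm 0]
    exact add_le_add (hSle _ (hgmaps hx)) (hSle _ (hgmaps hy))
  have hgl : edist (g x) (g y) ≤ L * edist x y := by
    simpa using edist_le_eHolderSemi_aux 1 zero_le_one g Ω hx hy
  have h2 : D ≤ H * (L * edist x y) ^ α := by
    have : D ≤ edist (f (g x)) (f (g y)) + edist (f' (g x)) (f' (g y)) := by
      rw [hD]
      simp only [edist_dist]
      rw [← ENNReal.ofReal_add dist_nonneg dist_nonneg]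
      exact ENNReal.ofReal_le_ofReal (dist_sub_sub_le _ _ _ _)
    refine this.trans ?_
    refine (add_le_add
      (edist_le_eHolderSemi_aux α hα0.le f Ω' (hgmaps hx) (hgmaps hy))
      (edist_le_eHolderSemi_aux α hα0.le f' Ω' (hgmaps hx) (hgmaps hy))).trans ?_
    rw [← add_mul]
    gcongr
  calc D = D ^ (1 - β / α) * D ^ (β / α) := by
        rw [← ENNReal.rpow_add_of_nonneg _ _ hθ1.le hθ0.le]
        simp
    _ ≤ (2 * S) ^ (1 - β / α) * (H * (L * edist x y) ^ α) ^ (β / α) := by gcongr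
    _ = _ := by
        rw [ENNReal.mul_rpow_of_nonneg _ _ hθ1.le, ENNReal.mul_rpow_of_nonneg _ _ hθ0.le,
          ← ENNReal.rpow_mul, mul_div_cancel₀ β hα0.ne', ENNReal.mul_rpow_of_nonneg _ _ hβ0.le]
        ring
end
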